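/- arXiv:2311.18562 — 10 statements merged into one kernel-verified Lean document; each statement's English description precedes it below -/
import Mathlib

section
/- Let A be a commutative ring, n ≥ 2 an integer, and a = (a_1,…,a_n), b = (b_1,…,b_n) ∈ A^n. Let M(a,b) be the n×n matrix over A with diagonal entries M_{i,i} = a_i for 1 ≤ i ≤ n, entries M_{i,i+1} = −b_i for 1 ≤ i ≤ n−1, entry M_{n,1} = −b_n, and all other entries 0. Then det M(a,b) = ∏_{i=1}^n a_i − ∏_{i=1}^n b_i, and for all 1 ≤ i,j ≤ n the (i,j)-entry of the adjugate matrix Adj(M(a,b)) equals J_{j+1,i−1}(a) · J_{i,j−1}(b). -/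
/-- The cyclic matrix `M(a,b)` with diagonal `a_i`, entries `-b_i` in position `(i, i+1)`
(indices mod `n`, so in particular `-b_n` in position `(n,1)`), and `0` elsewhere. -/
def cycMat {n : ℕ} [NeZero n] (A : Type*) [CommRing A] (a b : ZMod n → A) :
    Matrix (ZMod n) (ZMod n) A :=
  Matrix.of fun i j => if j = i then a i else if j = i + 1 then -(b i) else 0

/-- `J_{i,j}(x)`: equal to `1` if `i ≡ j+1 (mod n)`, and otherwise the product
`x_i x_{i+1} ⋯ x_{j'}` where `j'` is the smallest integer `≥ i` with `j' ≡ j (mod n)`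
(indices of `x` read modulo `n`). -/
def Jprod {n : ℕ} [NeZero n] {A : Type*} [CommRing A] (x : ZMod n → A) (i j : ZMod n) : A :=
  if i = j + 1 then 1 else ∏ k ∈ Finset.range ((j - i).val + 1), x (i + (k : ZMod n))

/-- The product `x_i x_{i+1} ⋯ x_{j-1}` along the cyclic arc from `i` to `j`, empty if `i = j`. -/
def arcProd {n : ℕ} [NeZero n] {A : Type*} [CommRing A] (x : ZMod n → A) (i j : ZMod n) : A :=
  ∏ k ∈ Finset.range (j - i).val, x (i + (k : ZMod n))

theorem ZMod.val_eq_val_sub_one_add_one {n : ℕ} [NeZero n] {c : ZMod n} (hc : c ≠ 0) :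
    c.val = (c - 1).val + 1 := by
  have hpos : 0 < c.val := Nat.pos_of_ne_zero fun h => hc ((ZMod.val_eq_zero c).1 h)
  have hlt := ZMod.val_lt c
  have h : c - 1 = ((c.val - 1 : ℕ) : ZMod n) := by
    rw [Nat.cast_sub hpos, ZMod.natCast_val, ZMod.cast_id, Nat.cast_one]
  rw [h, ZMod.val_cast_of_lt (by omega)]
  omega

theorem ZMod.val_neg_one_add_one (n : ℕ) [NeZero n] : (-1 : ZMod n).val + 1 = n := by
  obtain _ | m := n
  · exact absurd rfl (NeZero.ne 0)
  · rw [ZMod.val_neg_one]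

section ArcProd

variable {n : ℕ} [NeZero n] {A : Type*} [CommRing A] (x : ZMod n → A)

theorem Jprod_sub_one (i j : ZMod n) : Jprod x i (j - 1) = arcProd x i j := by
  unfold Jprod arcProd
  rw [sub_add_cancel]
  split_ifs with h
  · simp [h]
  · rw [ZMod.val_eq_val_sub_one_add_one (sub_ne_zero.2 (Ne.symm h)), sub_right_comm]

theorem arcProd_self (i : ZMod n) : arcProd x i i = 1 := by
  simp [arcProd]

theorem arcProd_add_one_right {i j : ZMod n} (h : i ≠ j + 1) :
    arcProd x i (j + 1) = arcProd x i j * x j := by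
  unfold arcProd
  rw [ZMod.val_eq_val_sub_one_add_one (sub_ne_zero.2 (Ne.symm h)), Finset.prod_range_succ,
    show j + 1 - i - 1 = j - i by ring, ZMod.natCast_val, ZMod.cast_id, add_sub_cancel]

theorem arcProd_eq_mul_arcProd_add_one {i j : ZMod n} (h : i ≠ j) :
    arcProd x i j = x i * arcProd x (i + 1) j := by
  unfold arcProd
  rw [ZMod.val_eq_val_sub_one_add_one (sub_ne_zero.2 (Ne.symm h)), Finset.prod_range_succ',
    sub_sub, Nat.cast_zero, add_zero, mul_comm]
  congr 1
  refine Finset.prod_congr rfl fun k _ => ?_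
  congr 1
  push_cast
  ring

theorem prod_range_add_natCast (i : ZMod n) :
    ∏ k ∈ Finset.range n, x (i + (k : ZMod n)) = ∏ k, x k := by
  refine Finset.prod_bij' (fun k _ => i + (k : ZMod n)) (fun k _ => (k - i).val)
    (fun _ _ => Finset.mem_univ _) (fun k _ => Finset.mem_range.2 (ZMod.val_lt _)) ?_ ?_ ?_
  · intro k hk
    simp [ZMod.val_cast_of_lt (Finset.mem_range.1 hk)]
  · simp
  · simp

theorem mul_arcProd_add_one_self (i : ZMod n) :
    x i * arcProd x (i + 1) i = ∏ k, x k := by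
  rw [← prod_range_add_natCast x (i + 1)]
  unfold arcProd
  have h : i - (i + 1) = -1 := by ring
  rw [← congrArg Finset.range (ZMod.val_neg_one_add_one n), Finset.prod_range_succ, h, ZMod.natCast_val, ZMod.cast_id, mul_comm,
    add_neg_cancel_right]

end ArcProd

theorem sign_addRight_one_zmod (n : ℕ) [NeZero n] :
    Equiv.Perm.sign (Equiv.addRight (1 : ZMod n)) = (-1) ^ (n - 1) := by
  obtain _ | m := n
  · exact absurd rfl (NeZero.ne 0)
  · have h : (Equiv.addRight (1 : ZMod (m + 1))) = finRotate (m + 1) := by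
      ext i
      exact (finRotate_apply i).symm
    rw [h]
    exact sign_finRotate (m + 1)

theorem add_one_ne_self_zmod {n : ℕ} (hn : 2 ≤ n) (i : ZMod n) : i + 1 ≠ i := by
  have : Fact (1 < n) := ⟨hn⟩
  simp

theorem zmod_perm_eq_one_or_addRight_one {n : ℕ} [NeZero n] (σ : Equiv.Perm (ZMod n))
    (h : ∀ i, σ i = i ∨ σ i = i + 1) : σ = 1 ∨ σ = Equiv.addRight 1 := by
  by_cases h1 : ∀ i, σ i = i
  · exact Or.inl (Equiv.ext h1)
  · right
    push Not at h1
    obtain ⟨i, hi⟩ := h1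
    have key : ∀ k : ℕ, σ (i + k) = i + k + 1 := by
      intro k
      induction k with
      | zero => simpa using (h i).resolve_left hi
      | succ k ih =>
        refine (h _).elim (fun h' => ?_) id
        have h2 : σ (i + (k + 1 : ℕ)) = σ (i + k) := by
          rw [h', ih]
          push_cast
          ring
        have h3 := σ.injective h2
        rw [h3, ih] at h'
        rw [h3, ih]
    ext j
    simpa using key (j - i).val

theorem det_cycMat {n : ℕ} [NeZero n] (hn : 2 ≤ n) {A : Type*} [CommRing A]
    (a b : ZMod n → A) : (cycMat A a b).det = (∏ i, a i) - (∏ i, b i) := by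
  have hne : (1 : Equiv.Perm (ZMod n)) ≠ Equiv.addRight 1 := fun h =>
    add_one_ne_self_zmod hn 0 (DFunLike.congr_fun h 0).symm
  rw [← Matrix.det_transpose, Matrix.det_apply',
    Finset.sum_eq_add_of_mem 1 (Equiv.addRight 1) (Finset.mem_univ _) (Finset.mem_univ _) hne]
  · have hpow : ((-1 : A)) ^ (n - 1) * (-1) ^ n = -1 := by
      rw [← pow_add, show n - 1 + n = 2 * (n - 1) + 1 by omega, pow_succ, pow_mul]
      simp
    simp only [sign_addRight_one_zmod, Matrix.transpose_apply, cycMat, Matrix.of_apply,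
      Equiv.coe_addRight, add_one_ne_self_zmod hn, if_true, if_false, Finset.prod_neg]
    simp [← mul_assoc, hpow, ZMod.card, sub_eq_add_neg]
  · rintro σ - ⟨h1, h2⟩
    have : ∃ i, σ i ≠ i ∧ σ i ≠ i + 1 := by
      by_contra! hc
      exact (zmod_perm_eq_one_or_addRight_one σ fun i => or_iff_not_imp_left.2 (hc i)).elim h1 h2
    obtain ⟨i, hi⟩ := this
    rw [Finset.prod_eq_zero (Finset.mem_univ i), mul_zero]
    simp [cycMat, hi.1, hi.2]

theorem cycMat_mulVec {n : ℕ} [NeZero n] (hn : 2 ≤ n) {A : Type*} [CommRing A]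
    (a b v : ZMod n → A) (i : ZMod n) :
    (cycMat A a b).mulVec v i = a i * v i - b i * v (i + 1) := by
  simp only [Matrix.mulVec, dotProduct]
  rw [Finset.sum_eq_add_of_mem i (i + 1) (Finset.mem_univ _) (Finset.mem_univ _)
    (add_one_ne_self_zmod hn i).symm]
  · simp [cycMat, add_one_ne_self_zmod hn, sub_eq_add_neg]
  · rintro j - ⟨h1, h2⟩
    simp [cycMat, h1, h2]

/-- The matrix of products of arcs that turns out to be the adjugate of `cycMat A a b`. -/
def arcMat {n : ℕ} [NeZero n] {A : Type*} [CommRing A] (a b : ZMod n → A) :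
    Matrix (ZMod n) (ZMod n) A :=
  Matrix.of fun i j => arcProd a (j + 1) i * arcProd b i j

theorem cycMat_mul_arcMat {n : ℕ} [NeZero n] (hn : 2 ≤ n) {A : Type*} [CommRing A]
    (a b : ZMod n → A) :
    cycMat A a b * arcMat a b = ((∏ i, a i) - (∏ i, b i)) • (1 : Matrix (ZMod n) (ZMod n) A) := by
  ext i j
  have h : (cycMat A a b * arcMat a b) i j =
      (cycMat A a b).mulVec (fun k => arcMat a b k j) i := rfl
  rw [h, cycMat_mulVec hn, Matrix.smul_apply, smul_eq_mul]
  simp only [arcMat, Matrix.of_apply]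
  rcases eq_or_ne i j with rfl | hij
  · rw [arcProd_self, arcProd_self, mul_one, one_mul, mul_arcProd_add_one_self,
      mul_arcProd_add_one_self, Matrix.one_apply_eq, mul_one]
  · rw [arcProd_add_one_right a (fun h => hij (add_right_cancel h).symm),
      arcProd_eq_mul_arcProd_add_one b hij, Matrix.one_apply_ne hij]
    ring

theorem adjugate_cycMat_of_isDomain {n : ℕ} [NeZero n] (hn : 2 ≤ n) {A : Type*} [CommRing A]
    [IsDomain A] (a b : ZMod n → A) (h : (∏ i, a i) - (∏ i, b i) ≠ 0) :
    (cycMat A a b).adjugate = arcMat a b := by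
  have h1 := congrArg (fun N => (cycMat A a b).adjugate * N) (cycMat_mul_arcMat hn a b)
  simp only [← Matrix.mul_assoc, Matrix.adjugate_mul, det_cycMat hn, Matrix.smul_mul,
    Matrix.one_mul, Matrix.mul_smul, Matrix.mul_one] at h1
  ext i j
  have h2 := congrFun (congrFun h1 i) j
  simp only [Matrix.smul_apply, smul_eq_mul] at h2
  exact (mul_left_cancel₀ h h2).symm

theorem map_cycMat {n : ℕ} [NeZero n] {A B : Type*} [CommRing A] [CommRing B] (f : A →+* B)
    (a b : ZMod n → A) :
    f.mapMatrix (cycMat A a b) = cycMat B (fun i => f (a i)) (fun i => f (b i)) := by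
  ext i j
  simp only [cycMat, RingHom.mapMatrix_apply, Matrix.map_apply, Matrix.of_apply]
  split_ifs <;> simp

theorem map_arcMat {n : ℕ} [NeZero n] {A B : Type*} [CommRing A] [CommRing B] (f : A →+* B)
    (a b : ZMod n → A) :
    f.mapMatrix (arcMat a b) = arcMat (fun i => f (a i)) (fun i => f (b i)) := by
  ext i j
  simp [arcMat, arcProd]

open MvPolynomial in
theorem adjugate_cycMat {n : ℕ} [NeZero n] (hn : 2 ≤ n) {A : Type*} [CommRing A]
    (a b : ZMod n → A) : (cycMat A a b).adjugate = arcMat a b := by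
  let R := MvPolynomial (ZMod n ⊕ ZMod n) ℤ
  let X₁ : ZMod n → R := fun i => X (Sum.inl i)
  let X₂ : ZMod n → R := fun i => X (Sum.inr i)
  have hne : (∏ i, X₁ i) - (∏ i, X₂ i) ≠ 0 := by
    intro h
    have h' := congrArg (eval (Sum.elim (fun _ => (1 : ℤ)) (fun _ => 0))) h
    simp [X₁, X₂, map_prod, ZMod.card, NeZero.ne n] at h'
  let f : R →+* A := eval₂Hom (Int.castRingHom A) (Sum.elim a b)
  have hf := congrArg f.mapMatrix (adjugate_cycMat_of_isDomain hn X₁ X₂ hne)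
  rw [RingHom.map_adjugate, map_cycMat, map_arcMat] at hf
  have ha : (fun i => f (X₁ i)) = a := funext fun i => eval₂Hom_X' _ _ _
  have hb : (fun i => f (X₂ i)) = b := funext fun i => eval₂Hom_X' _ _ _
  rwa [ha, hb] at hf

/-- Lemma 3.2: `det M(a,b) = ∏ a_i − ∏ b_i`, and the `(i,j)`-entry of the adjugate of
`M(a,b)` is `J_{j+1,i−1}(a) · J_{i,j−1}(b)`. -/
theorem det_and_adjugate_cycMat {n : ℕ} [NeZero n] (hn : 2 ≤ n) (A : Type*) [CommRing A]
    (a b : ZMod n → A) :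
    (cycMat A a b).det = (∏ i, a i) - (∏ i, b i) ∧
    ∀ i j : ZMod n, (cycMat A a b).adjugate i j =
      Jprod a (j + 1) (i - 1) * Jprod b i (j - 1) := by
  refine ⟨det_cycMat hn a b, fun i j => ?_⟩
  rw [adjugate_cycMat hn, Jprod_sub_one, Jprod_sub_one]
  rfl
end

section
/- For every parabolic type R ⊆ E_n and every subset S ⊆ E_n, the cone 𝒞_{pHa,S} is an S-adapted p-cone: there exists a function ρ : S → 𝒫(E_n) such that 𝒞_{pHa,S} = {x ∈ ℤ^n : F_{ρ(i)}^{(i)}(x) ≤ 0 for all i ∈ S}. -/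
open scoped Pointwise

/-- The sign `δ_A^{(i)}`: `-1` if `i ∈ A`, `1` otherwise. -/
def sgn {n : ℕ} (A : Finset (ZMod n)) (i : ZMod n) : ℤ := if i ∈ A then -1 else 1

/-- The `p`-expression `F_T^{(d)}(x) = Σ_{i=0}^{n−1} p^i δ_T^{(d+i)} x_{d+i}`. -/
def pExpr (p : ℕ) {n : ℕ} (T : Finset (ZMod n)) (d : ZMod n) (x : ZMod n → ℤ) : ℤ :=
  ∑ i ∈ Finset.range n, (p : ℤ) ^ i * sgn T (d + (i : ZMod n)) * x (d + (i : ZMod n))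

/-- The `S`-adapted `p`-cone associated to `γ`. -/
def adapCone (p : ℕ) {n : ℕ} (S : Finset (ZMod n)) (γ : ZMod n → Finset (ZMod n)) :
    Set (ZMod n → ℤ) :=
  {x | ∀ i ∈ S, pExpr p (γ i) i x ≤ 0}

/-- The vector `ha_{R,S}^{(i)}`. -/
def haVec (p : ℕ) {n : ℕ} (R S : Finset (ZMod n)) (i : ZMod n) : ZMod n → ℤ :=
  (if i ∈ S then (1 : ℤ) else -1) • Pi.single i (1 : ℤ)
    - ((p : ℤ) * sgn R (i - 1)) • Pi.single (i - 1) (1 : ℤ)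

/-- Saturation of a subset of `ℤ^n`. -/
def satur {n : ℕ} (C : Set (ZMod n → ℤ)) : Set (ZMod n → ℤ) :=
  {x | ∃ m : ℕ, 1 ≤ m ∧ (m : ℤ) • x ∈ C}

/-- The cone of partial Hasse invariants `𝒞_{pHa,S}`. -/
def CpHa (p : ℕ) {n : ℕ} [NeZero n] (R S : Finset (ZMod n)) : Set (ZMod n → ℤ) :=
  satur {x | ∃ c : ZMod n → ℤ, (∀ i ∈ S, 0 ≤ c i) ∧ x = ∑ i, c i • haVec p R S i}

/-- The kernel `𝕂_{R,S}`. -/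
def haKer (p : ℕ) {n : ℕ} [NeZero n] (R S : Finset (ZMod n)) : Set (ZMod n → ℤ) :=
  satur {x | ∃ c : ZMod n → ℤ, (∀ i ∈ S, c i = 0) ∧ x = ∑ i, c i • haVec p R S i}

/-- `T` is admissible with respect to `R` and `S`. -/
def Admissible {n : ℕ} (R S T : Finset (ZMod n)) : Prop :=
  ∀ i : ZMod n, i + 1 ∉ S →
    if i ∈ R then (i ∈ T ↔ i + 1 ∈ T) else (i ∈ T ↔ i + 1 ∉ T)

/-- `T` is `i`-positive. -/
def IPositive {n : ℕ} (R T : Finset (ZMod n)) (i : ZMod n) : Prop :=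
  i - 1 ∈ T ↔ i - 1 ∈ R

lemma sgn_mul_self {n : ℕ} (A : Finset (ZMod n)) (i : ZMod n) : sgn A i * sgn A i = 1 := by
  unfold sgn
  split_ifs <;> norm_num

/-- The partial product `∏_{k<i} g (j+k)`. -/
def shiftProd {n : ℕ} (g : ZMod n → ℤ) (j : ZMod n) (i : ℕ) : ℤ :=
  ∏ k ∈ Finset.range i, g (j + (k : ZMod n))

lemma shiftProd_succ {n : ℕ} (g : ZMod n → ℤ) (j : ZMod n) (i : ℕ) :
    shiftProd g j (i + 1) = shiftProd g j i * g (j + i) :=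
  Finset.prod_range_succ _ _

lemma shiftProd_succ_left {n : ℕ} (g : ZMod n → ℤ) (j : ZMod n) (i : ℕ) :
    shiftProd g j (i + 1) = g j * shiftProd g (j + 1) i := by
  unfold shiftProd
  rw [Finset.prod_range_succ', mul_comm, Nat.cast_zero, add_zero]
  congr 1
  refine Finset.prod_congr rfl fun k _ => ?_
  congr 1
  push_cast
  ring

lemma shiftProd_mul_self {n : ℕ} {g : ZMod n → ℤ} (hg : ∀ i, g i * g i = 1) (j : ZMod n)
    (i : ℕ) : shiftProd g j i * shiftProd g j i = 1 := by
  unfold shiftProd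
  rw [← Finset.prod_mul_distrib]
  exact Finset.prod_eq_one fun k _ => hg _

/-- The product over a full period does not depend on the starting index. -/
lemma shiftProd_period {n : ℕ} [NeZero n] {g : ZMod n → ℤ} (hg : ∀ i, g i * g i = 1)
    (j : ZMod n) : shiftProd g j n = shiftProd g 0 n := by
  have step (j : ZMod n) : shiftProd g (j + 1) n = shiftProd g j n := by
    have h := shiftProd_succ g j n
    rw [shiftProd_succ_left, ZMod.natCast_self, add_zero] at h
    linear_combination g j * h + (shiftProd g j n - shiftProd g (j + 1) n) * hg j
  have key (m : ℕ) : shiftProd g (m : ZMod n) n = shiftProd g 0 n := by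
    induction m with
    | zero => rw [Nat.cast_zero]
    | succ m ih => rw [Nat.cast_succ, step, ih]
  simpa using key j.val

/-- The twisted `p`-expression which, up to a constant, recovers the `d`-th coefficient of a vector
`x` with `x_j = ε_j c_j - p r_j c_{j+1}`. -/
def coeffForm (p : ℕ) {n : ℕ} (ε r : ZMod n → ℤ) (d : ZMod n) (x : ZMod n → ℤ) : ℤ :=
  ∑ i ∈ Finset.range n, (p : ℤ) ^ i * (shiftProd (ε * r) d i * ε (d + (i : ZMod n))) *
    x (d + (i : ZMod n))

lemma coeffForm_apply {p n : ℕ} {ε r x c : ZMod n → ℤ} (hε : ∀ i, ε i * ε i = 1)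
    (hx : ∀ j, x j = ε j * c j - p * r j * c (j + 1)) (d : ZMod n) :
    coeffForm p ε r d x = (1 - (p : ℤ) ^ n * shiftProd (ε * r) d n) * c d := by
  let f (i : ℕ) : ℤ := (p : ℤ) ^ i * shiftProd (ε * r) d i * c (d + i)
  have h : coeffForm p ε r d x = ∑ i ∈ Finset.range n, (f i - f (i + 1)) := by
    refine Finset.sum_congr rfl fun i _ => ?_
    simp only [f, hx, shiftProd_succ, Pi.mul_apply, Nat.cast_succ, add_assoc]
    linear_combination (p : ℤ) ^ i * shiftProd (ε * r) d i * c (d + i) * hε (d + i)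
  rw [h, Finset.sum_range_sub']
  simp [f, shiftProd]
  ring

lemma coeffForm_sub {p n : ℕ} {ε r : ZMod n → ℤ} (hε : ∀ i, ε i * ε i = 1)
    (x : ZMod n → ℤ) (d : ZMod n) :
    ε d * coeffForm p ε r d x - p * r d * coeffForm p ε r (d + 1) x =
      (1 - (p : ℤ) ^ n * shiftProd (ε * r) d n) * x d := by
  let f (i : ℕ) : ℤ :=
    (p : ℤ) ^ i * (shiftProd (ε * r) d i * ε (d + (i : ZMod n))) * x (d + (i : ZMod n))
  have h : ε d * coeffForm p ε r d x - p * r d * coeffForm p ε r (d + 1) x =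
      ∑ i ∈ Finset.range n, (ε d * f i - ε d * f (i + 1)) := by
    unfold coeffForm
    rw [Finset.mul_sum, Finset.mul_sum, ← Finset.sum_sub_distrib]
    refine Finset.sum_congr rfl fun i _ => ?_
    have e : d + ((i + 1 : ℕ) : ZMod n) = d + 1 + i := by push_cast; ring
    simp only [f, shiftProd_succ_left, Pi.mul_apply, e]
    linear_combination (p : ℤ) ^ (i + 1) * r d * shiftProd (ε * r) (d + 1) i * ε (d + 1 + i) *
      x (d + 1 + i) * hε d
  rw [h, Finset.sum_range_sub' (fun i => ε d * f i)]
  simp only [f, pow_zero, shiftProd, Finset.range_zero, Finset.prod_empty, Nat.cast_zero,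
    add_zero, ZMod.natCast_self]
  linear_combination (1 - (p : ℤ) ^ n * ∏ k ∈ Finset.range n, (ε * r) (d + k)) * x d * hε d

lemma coeffForm_smul (p : ℕ) {n : ℕ} (ε r : ZMod n → ℤ) (d : ZMod n) (m : ℤ)
    (x : ZMod n → ℤ) : coeffForm p ε r d (m • x) = m * coeffForm p ε r d x := by
  unfold coeffForm
  rw [Finset.mul_sum]
  refine Finset.sum_congr rfl fun i _ => ?_
  rw [Pi.smul_apply, smul_eq_mul]
  ring

/-- Every `p`-expression whose coefficients have arbitrary signs is of the form `F_T^{(d)}`. -/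
lemma exists_pExpr_eq_mul_coeffForm (p : ℕ) {n : ℕ} {ε r : ZMod n → ℤ}
    (hε : ∀ i, ε i * ε i = 1) (hr : ∀ i, r i * r i = 1) {τ : ℤ} (hτ : τ * τ = 1) (d : ZMod n) :
    ∃ T : Finset (ZMod n), ∀ x, pExpr p T d x = τ * coeffForm p ε r d x := by
  classical
  let s (i : ℕ) : ℤ := τ * (shiftProd (ε * r) d i * ε (d + (i : ZMod n)))
  let T : Finset (ZMod n) :=
    ((Finset.range n).filter fun i => s i = -1).image fun i : ℕ => d + (i : ZMod n)
  have hs (i : ℕ) : s i = 1 ∨ s i = -1 := by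
    have hg (i : ZMod n) : (ε * r) i * (ε * r) i = 1 := by
      simp only [Pi.mul_apply]
      linear_combination r i * r i * hε i + hr i
    have h : s i * s i = 1 := by
      calc s i * s i = (τ * τ) * (shiftProd (ε * r) d i * shiftProd (ε * r) d i) *
            (ε (d + (i : ZMod n)) * ε (d + (i : ZMod n))) := by simp only [s]; ring
        _ = 1 := by rw [hτ, shiftProd_mul_self hg, hε]; norm_num
    exact mul_self_eq_one_iff.mp h
  have hT (i : ℕ) (hi : i < n) : sgn T (d + (i : ZMod n)) = s i := by
    have hmem : d + (i : ZMod n) ∈ T ↔ s i = -1 := by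
      simp only [T, Finset.mem_image, Finset.mem_filter, Finset.mem_range, add_right_inj]
      constructor
      · rintro ⟨k, ⟨hk, hsk⟩, hki⟩
        have : k = i := by
          rw [← ZMod.val_cast_of_lt hk, ← ZMod.val_cast_of_lt hi, hki]
        exact this ▸ hsk
      · exact fun h => ⟨i, ⟨hi, h⟩, rfl⟩
    unfold sgn
    rcases hs i with h | h
    · rw [if_neg (by rw [hmem, h]; norm_num), h]
    · rw [if_pos (hmem.mpr h), h]
  refine ⟨T, fun x => ?_⟩
  unfold pExpr coeffForm
  rw [Finset.mul_sum]
  refine Finset.sum_congr rfl fun i hi => ?_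
  rw [hT i (Finset.mem_range.mp hi)]
  simp only [s]
  ring

lemma sum_smul_haVec_apply (p : ℕ) {n : ℕ} [NeZero n] (R S : Finset (ZMod n))
    (c : ZMod n → ℤ) (j : ZMod n) :
    (∑ i, c i • haVec p R S i) j =
      (if j ∈ S then (1 : ℤ) else -1) * c j - p * sgn R j * c (j + 1) := by
  simp only [haVec, Finset.sum_apply, Pi.smul_apply, Pi.sub_apply, smul_eq_mul, mul_sub,
    Finset.sum_sub_distrib]
  congr 1
  · rw [Finset.sum_eq_single j]
    · rw [Pi.single_eq_same]
      ring
    · intro b _ hb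
      rw [Pi.single_eq_of_ne hb.symm]
      ring
    · simp
  · rw [Finset.sum_eq_single (j + 1)]
    · rw [add_sub_cancel_right, Pi.single_eq_same]
      ring
    · intro b _ hb
      rw [Pi.single_eq_of_ne]
      · ring
      · rintro rfl
        exact hb (sub_add_cancel b 1).symm
    · simp

/-- Proposition 4.3: for every parabolic type `R ⊆ E_n` and every subset `S ⊆ E_n`,
the cone `𝒞_{pHa,S}` is an `S`-adapted `p`-cone. -/
theorem CpHa_isAdapted (p : ℕ) (hp : p.Prime) {n : ℕ} [NeZero n]
    (R S : Finset (ZMod n)) :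
    ∃ ρ : ZMod n → Finset (ZMod n), CpHa p R S = adapCone p S ρ := by
  let ε (j : ZMod n) : ℤ := if j ∈ S then 1 else -1
  have hε (j : ZMod n) : ε j * ε j = 1 := by
    simp only [ε]
    split_ifs <;> norm_num
  have hg (j : ZMod n) : (ε * sgn R) j * (ε * sgn R) j = 1 := by
    simp only [Pi.mul_apply]
    linear_combination sgn R j * sgn R j * hε j + sgn_mul_self R j
  let D : ℤ := 1 - (p : ℤ) ^ n * shiftProd (ε * sgn R) 0 n
  obtain ⟨τ, hτ, hD⟩ : ∃ τ : ℤ, τ * τ = 1 ∧ τ * D < 0 := by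
    have h1 : (1 : ℤ) < (p : ℤ) ^ n :=
      one_lt_pow₀ (by exact_mod_cast hp.one_lt) (NeZero.ne n)
    rcases mul_self_eq_one_iff.mp (shiftProd_mul_self hg 0 n) with h | h
    · exact ⟨1, by norm_num, by simp only [D, h]; linarith⟩
    · exact ⟨-1, by norm_num, by simp only [D, h]; linarith⟩
  choose ρ hρ using exists_pExpr_eq_mul_coeffForm p hε (sgn_mul_self R) hτ
  refine ⟨ρ, Set.ext fun x => ⟨?_, fun hx => ?_⟩⟩
  · rintro ⟨m, hm, c, hc, hxc⟩ d hd
    have h := coeffForm_apply (p := p) (r := sgn R) hε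
      (fun j => (congrFun hxc j).trans (sum_smul_haVec_apply p R S c j)) d
    rw [coeffForm_smul, shiftProd_period hg] at h
    have hle : (m : ℤ) * pExpr p (ρ d) d x ≤ 0 := by
      rw [hρ]
      calc (m : ℤ) * (τ * coeffForm p ε (sgn R) d x) = τ * D * c d := by
            linear_combination τ * h
        _ ≤ 0 := mul_nonpos_of_nonpos_of_nonneg hD.le (hc d hd)
    exact nonpos_of_mul_nonpos_right hle (by exact_mod_cast hm)
  · refine ⟨(-(τ * D)).toNat, by omega, fun d => -(τ * coeffForm p ε (sgn R) d x), ?_, ?_⟩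
    · intro d hd
      have h := hx d hd
      rw [hρ] at h
      linarith
    · funext j
      rw [sum_smul_haVec_apply, Int.toNat_of_nonneg (by linarith), Pi.smul_apply, smul_eq_mul]
      have h := coeffForm_sub (p := p) (r := sgn R) hε x j
      rw [shiftProd_period hg] at h
      linear_combination τ * h
end

section
/- For every parabolic type R ⊆ E_n and every nonempty subset S ⊆ E_n, there exists a unique subset T ⊆ E_n such that T is admissible with respect to R and S, and T is i-positive for every i ∈ S. Consequently there is a unique positive admissible homogeneous S-adapted p-cone. -/
open scoped Pointwise

/-- One step of the recursion determining `j ∈ T` from `j + 1 ∈ T`: the fixed points are the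
admissible sets that are `i`-positive for all `i ∈ S`. -/
def admissibleStep {n : ℕ} [NeZero n] (R S T : Finset (ZMod n)) : Finset (ZMod n) :=
  {j | j ∈ R ↔ (j + 1 ∈ S ∨ j + 1 ∈ T)}

theorem mem_admissibleStep {n : ℕ} [NeZero n] {R S T : Finset (ZMod n)} {j : ZMod n} :
    j ∈ admissibleStep R S T ↔ (j ∈ R ↔ (j + 1 ∈ S ∨ j + 1 ∈ T)) := by
  simp [admissibleStep]

theorem admissible_and_iPositive_iff {n : ℕ} [NeZero n] {R S T : Finset (ZMod n)} :
    (Admissible R S T ∧ ∀ i ∈ S, IPositive R T i) ↔ admissibleStep R S T = T := by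
  have hpos : (∀ i ∈ S, IPositive R T i) ↔ ∀ j, j + 1 ∈ S → (j ∈ T ↔ j ∈ R) := by
    refine ⟨fun h j hj => ?_, fun h i hi => h (i - 1) (by simpa using hi)⟩
    simpa [IPositive] using h (j + 1) hj
  rw [hpos, Admissible, ← forall_and, Finset.ext_iff]
  refine forall_congr' fun j => ?_
  rw [mem_admissibleStep]
  split_ifs <;> tauto

theorem mem_iterate_admissibleStep_congr {n : ℕ} [NeZero n] (R S A B : Finset (ZMod n)) (k : ℕ) :
    ∀ (j : ZMod n) (m : ℕ), m < k → j + 1 + m ∈ S →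
      (j ∈ (admissibleStep R S)^[k] A ↔ j ∈ (admissibleStep R S)^[k] B) := by
  induction k with
  | zero => intro j m hm; omega
  | succ k ih =>
    intro j m hm hj
    rw [Function.iterate_succ_apply', Function.iterate_succ_apply', mem_admissibleStep,
      mem_admissibleStep]
    rcases m with _ | m
    · simp only [Nat.cast_zero, add_zero] at hj
      simp [hj]
    · rw [ih (j + 1) m (by omega) (by convert hj using 1; push_cast; ring)]

theorem iterate_admissibleStep_eq {n : ℕ} [NeZero n] {R S : Finset (ZMod n)} (hS : S.Nonempty)
    (A B : Finset (ZMod n)) :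
    (admissibleStep R S)^[n] A = (admissibleStep R S)^[n] B := by
  obtain ⟨s, hs⟩ := hS
  ext j
  refine mem_iterate_admissibleStep_congr R S A B n j (s - (j + 1)).val (ZMod.val_lt _) ?_
  simpa using hs

theorem existsUnique_admissibleStep_eq {n : ℕ} [NeZero n] {R S : Finset (ZMod n)}
    (hS : S.Nonempty) : ∃! T, admissibleStep R S T = T := by
  refine ⟨(admissibleStep R S)^[n] ∅, ?_, fun T hT => ?_⟩
  · exact ((Function.iterate_succ_apply' _ _ _).symm.trans (Function.iterate_succ_apply _ _ _)).trans
      (iterate_admissibleStep_eq hS _ _)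
  · exact (Function.iterate_fixed hT n).symm.trans (iterate_admissibleStep_eq hS _ _)

/-- Theorem A / Proposition 5.1: for every parabolic type `R` and every nonempty `S ⊆ E_n`,
there is a unique subset `T ⊆ E_n` which is admissible w.r.t. `R` and `S` and `i`-positive for
every `i ∈ S`; consequently there is a unique positive admissible homogeneous
`S`-adapted `p`-cone. -/
theorem existsUnique_positive_admissible_homogeneous (p : ℕ) (hp : p.Prime) {n : ℕ} [NeZero n]
    (R S : Finset (ZMod n)) (hS : S.Nonempty) :
    (∃! T : Finset (ZMod n), Admissible R S T ∧ ∀ i ∈ S, IPositive R T i) ∧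
    (∃! C : Set (ZMod n → ℤ), ∃ T : Finset (ZMod n),
      Admissible R S T ∧ (∀ i ∈ S, IPositive R T i) ∧ C = adapCone p S (fun _ => T)) := by
  simp_rw [← and_assoc, admissible_and_iPositive_iff]
  have h := existsUnique_admissibleStep_eq (R := R) hS
  refine ⟨h, ?_⟩
  obtain ⟨T, hT, huniq⟩ := h
  refine ⟨_, ⟨T, hT, rfl⟩, ?_⟩
  rintro C ⟨T', hT', rfl⟩
  rw [huniq T' hT']
end

section
/- Let R ⊆ E_n be a parabolic type, S ⊆ E_n a nonempty subset, γ : S → 𝒫(E_n) a function and C_γ the associated S-adapted p-cone. Then γ(i) is admissible with respect to R and S for every i ∈ S if and only if 𝕂_{R,S} ⊆ C_γ. -/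
open scoped Pointwise

/-- The `p`-expression as a sum over all indices, weighted by the distance to `d`. -/
lemma pExpr_eq_sum (p : ℕ) {n : ℕ} [NeZero n] (T : Finset (ZMod n)) (d : ZMod n)
    (x : ZMod n → ℤ) :
    pExpr p T d x = ∑ j, (p : ℤ) ^ (j - d).val * sgn T j * x j := by
  refine Finset.sum_bij' (fun i _ ↦ d + (i : ZMod n)) (fun j _ ↦ (j - d).val) ?_ ?_ ?_ ?_ ?_
  · simp
  · intro j _
    simpa using ZMod.val_lt (j - d)
  · intro i hi
    simpa using ZMod.val_cast_of_lt (Finset.mem_range.mp hi)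
  · simp
  · intro i hi
    simp [ZMod.val_cast_of_lt (Finset.mem_range.mp hi)]

lemma pExpr_smul (p : ℕ) {n : ℕ} (T : Finset (ZMod n)) (d : ZMod n) (m : ℤ)
    (x : ZMod n → ℤ) : pExpr p T d (m • x) = m * pExpr p T d x := by
  simp only [pExpr, Pi.smul_apply, smul_eq_mul, Finset.mul_sum]
  exact Finset.sum_congr rfl fun _ _ ↦ by ring

lemma pExpr_sum_smul (p : ℕ) {n : ℕ} {ι : Type*} (s : Finset ι) (T : Finset (ZMod n))
    (d : ZMod n) (c : ι → ℤ) (v : ι → ZMod n → ℤ) :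
    pExpr p T d (∑ i ∈ s, c i • v i) = ∑ i ∈ s, c i * pExpr p T d (v i) := by
  simp only [← pExpr_smul]
  simp only [pExpr, Finset.sum_apply, Finset.mul_sum]
  exact Finset.sum_comm

/-- The value of a `p`-expression on a vector `ha_{R,S}^{(i)}` with `i ∉ S`, away from the
starting index. -/
lemma pExpr_haVec (p : ℕ) {n : ℕ} [NeZero n] (R S T : Finset (ZMod n)) {d i : ZMod n}
    (hd : i ≠ d) (hi : i ∉ S) :
    pExpr p T d (haVec p R S i)
      = -((p : ℤ) ^ (i - d).val * (sgn T i + sgn R (i - 1) * sgn T (i - 1))) := by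
  have hval : (i - d).val = (i - 1 - d).val + 1 := by
    have h0 : (i - d).val ≠ 0 := by simpa [ZMod.val_eq_zero, sub_eq_zero] using hd
    have hlt := ZMod.val_lt (i - d)
    have h : i - 1 - d = (((i - d).val - 1 : ℕ) : ZMod n) := by
      rw [Nat.cast_sub (by omega), ZMod.natCast_zmod_val]
      push_cast
      ring
    rw [h, ZMod.val_cast_of_lt (by omega)]
    omega
  rw [pExpr_eq_sum]
  simp only [haVec, hi, if_false, Pi.sub_apply, Pi.smul_apply, smul_eq_mul, mul_sub,
    Finset.sum_sub_distrib, Pi.single_apply, mul_ite, mul_one, mul_zero, Finset.sum_ite_eq',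
    Finset.mem_univ, if_true, hval, pow_succ]
  ring

/-- Admissibility is the vanishing of the `p`-expression on the generators of the kernel. -/
lemma admissible_iff_pExpr_haVec_eq_zero (p : ℕ) (hp : p ≠ 0) {n : ℕ} [NeZero n]
    (R S T : Finset (ZMod n)) {d : ZMod n} (hd : d ∈ S) :
    Admissible R S T ↔ ∀ i ∉ S, pExpr p T d (haVec p R S i) = 0 := by
  have key (i : ZMod n) (hi : i + 1 ∉ S) : pExpr p T d (haVec p R S (i + 1)) = 0 ↔
      if i ∈ R then (i ∈ T ↔ i + 1 ∈ T) else (i ∈ T ↔ i + 1 ∉ T) := by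
    rw [pExpr_haVec p R S T (ne_of_mem_of_not_mem hd hi).symm hi, neg_eq_zero, mul_eq_zero,
      or_iff_right (pow_ne_zero _ (Nat.cast_ne_zero.mpr hp)), add_sub_cancel_right]
    by_cases h₁ : i ∈ R <;> by_cases h₂ : i ∈ T <;> by_cases h₃ : i + 1 ∈ T <;>
      simp [sgn, h₁, h₂, h₃]
  refine ⟨fun h i hi ↦ ?_, fun h i hi ↦ (key i hi).mp (h _ hi)⟩
  have hi' : i - 1 + 1 ∉ S := by simpa using hi
  simpa using (key (i - 1) hi').mpr (h (i - 1) hi')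

lemma smul_haVec_mem_haKer (p : ℕ) {n : ℕ} [NeZero n] (R S : Finset (ZMod n)) {i : ZMod n}
    (hi : i ∉ S) (a : ℤ) : a • haVec p R S i ∈ haKer p R S := by
  refine ⟨1, le_rfl, Pi.single i a, fun j hj ↦ by simp [ne_of_mem_of_not_mem hj hi], ?_⟩
  rw [Finset.sum_eq_single i (fun j _ hj ↦ by simp [hj]) (by simp)]
  simp

/-- Lemma 4.9: an `S`-adapted `p`-cone `C_γ` is admissible if and only if it contains the
kernel `𝕂_{R,S}`. -/
theorem admissible_iff_ker_subset (p : ℕ) (hp : p.Prime) {n : ℕ} [NeZero n]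
    (R S : Finset (ZMod n)) (hS : S.Nonempty) (γ : ZMod n → Finset (ZMod n)) :
    (∀ i ∈ S, Admissible R S (γ i)) ↔ haKer p R S ⊆ adapCone p S γ := by
  constructor
  · rintro h x ⟨m, hm, c, hc, hx⟩ d hd
    have hzero : (m : ℤ) * pExpr p (γ d) d x = 0 := by
      rw [← pExpr_smul, hx, pExpr_sum_smul]
      refine Finset.sum_eq_zero fun i _ ↦ ?_
      by_cases hi : i ∈ S
      · rw [hc i hi, zero_mul]
      · rw [(admissible_iff_pExpr_haVec_eq_zero p hp.ne_zero R S _ hd).mp (h d hd) i hi, mul_zero]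
    exact ((mul_eq_zero.mp hzero).resolve_left (by omega)).le
  · intro h d hd
    refine (admissible_iff_pExpr_haVec_eq_zero p hp.ne_zero R S _ hd).mpr fun i hi ↦ ?_
    have hle (a : ℤ) : a * pExpr p (γ d) d (haVec p R S i) ≤ 0 :=
      pExpr_smul p (γ d) d a _ ▸ h (smul_haVec_mem_haKer p R S hi a) d hd
    linarith [hle 1, hle (-1)]
end

section
/- Let R ⊆ E_n be a parabolic type, S ⊆ E_n a nonempty subset, γ : S → 𝒫(E_n) a function and C_γ the associated S-adapted p-cone. Define the limit cone C_∞ = {x ∈ ℤ^n : δ_{γ(i)}^{(i−1)} · x_{i−1} ≤ 0 for all i ∈ S} and the open Griffiths–Schmid cone 𝒞_{GS}° = {x ∈ ℤ^n : x_i > 0 for all i ∈ R and x_i < 0 for all i ∈ E_n ∖ R}. Then C_γ is positive (i.e. γ(i) is i-positive for every i ∈ S) if and only if 𝒞_{GS}° ⊆ C_∞. -/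
open scoped Pointwise

/-- Proposition 4.12: an `S`-adapted `p`-cone `C_γ` is positive if and only if the open
Griffiths–Schmid cone is contained in its limit cone `C_∞`. -/
theorem positive_iff_GS_subset_limit (p : ℕ) (hp : p.Prime) {n : ℕ} [NeZero n]
    (R S : Finset (ZMod n)) (hS : S.Nonempty) (γ : ZMod n → Finset (ZMod n)) :
    (∀ i ∈ S, IPositive R (γ i) i) ↔
      {x : ZMod n → ℤ | (∀ i ∈ R, 0 < x i) ∧ ∀ i : ZMod n, i ∉ R → x i < 0} ⊆
        {x : ZMod n → ℤ | ∀ i ∈ S, sgn (γ i) (i - 1) * x (i - 1) ≤ 0} := by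
  constructor
  · rintro h x ⟨hpos, hneg⟩ i hi
    have hiff : i - 1 ∈ γ i ↔ i - 1 ∈ R := h i hi
    by_cases hR : i - 1 ∈ R
    · have := hpos _ hR
      simp only [sgn, hiff.2 hR, if_true]
      linarith
    · have := hneg _ hR
      simp only [sgn, mt hiff.1 hR, if_false]
      linarith
  · intro h i hi
    have hx : (fun j => -sgn R j) ∈
        {x : ZMod n → ℤ | (∀ i ∈ R, 0 < x i) ∧ ∀ i : ZMod n, i ∉ R → x i < 0} :=
      ⟨fun j hj => by simp [sgn, hj], fun j hj => by simp [sgn, hj]⟩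
    have hle : sgn (γ i) (i - 1) * -sgn R (i - 1) ≤ 0 := h hx i hi
    unfold IPositive
    by_cases hR : i - 1 ∈ R <;> by_cases hT : i - 1 ∈ γ i <;> simp_all [sgn]
end

section
/- Let S ⊆ E_n be a subset and γ : S → 𝒫(E_n) any function. Then the linear forms F_{γ(i)}^{(i)} : ℚ^n → ℚ, for i ∈ S, are linearly independent over ℚ. -/
open scoped Pointwise

/-- The `p`-expression `F_T^{(d)}`, regarded as a linear form on `ℚ^n`. -/
noncomputable def pExprLinQ (p : ℕ) {n : ℕ} (T : Finset (ZMod n)) (d : ZMod n) :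
    (ZMod n → ℚ) →ₗ[ℚ] ℚ :=
  ∑ i ∈ Finset.range n,
    ((p : ℚ) ^ i * ((sgn T (d + (i : ZMod n)) : ℤ) : ℚ)) • LinearMap.proj (d + (i : ZMod n))

/-- Modulo `p`, only the leading term of a `p`-expression survives. -/
lemma pExpr_cast_zmod (p : ℕ) {n : ℕ} [NeZero n] (T : Finset (ZMod n)) (d : ZMod n)
    (x : ZMod n → ℤ) : ((pExpr p T d x : ℤ) : ZMod p) = (sgn T d : ZMod p) * (x d : ZMod p) := by
  rw [pExpr, Int.cast_sum, Finset.sum_eq_single_of_mem 0 (Finset.mem_range.2 (NeZero.pos n))]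
  · simp
  · intro i _ hi
    simp [hi]

lemma pExprLinQ_intCast (p : ℕ) {n : ℕ} (T : Finset (ZMod n)) (d : ZMod n) (x : ZMod n → ℤ) :
    pExprLinQ p T d (fun j => (x j : ℚ)) = (pExpr p T d x : ℚ) := by
  simp [pExprLinQ, pExpr, LinearMap.sum_apply]

/-- The coefficient matrix of a family of `p`-expressions, one for each starting index, is
diagonal with entries `±1` modulo `p`, hence nonsingular. -/
lemma det_pExpr_ne_zero (p : ℕ) (hp : p.Prime) {n : ℕ} [NeZero n]
    (γ : ZMod n → Finset (ZMod n)) :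
    (Matrix.of fun d j : ZMod n => pExpr p (γ d) d (Pi.single j 1)).det ≠ 0 := by
  have : Fact p.Prime := ⟨hp⟩
  intro h
  have hdiag : (Matrix.of fun d j : ZMod n => pExpr p (γ d) d (Pi.single j 1)).map
      (Int.castRingHom (ZMod p)) = Matrix.diagonal fun d => (sgn (γ d) d : ZMod p) := by
    ext d j
    by_cases hdj : d = j <;> simp [pExpr_cast_zmod, hdj]
  have hdet := RingHom.map_det (Int.castRingHom (ZMod p))
    (Matrix.of fun d j : ZMod n => pExpr p (γ d) d (Pi.single j 1))
  rw [h, map_zero, RingHom.mapMatrix_apply, hdiag, Matrix.det_diagonal] at hdet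
  refine Finset.prod_ne_zero_iff.2 (fun d _ => ?_) hdet.symm
  unfold sgn
  split_ifs <;> simp

/-- Lemma 4.17: for any `S ⊆ E_n` and any `γ : S → 𝒫(E_n)`, the linear forms
`F_{γ(i)}^{(i)} : ℚ^n → ℚ` for `i ∈ S` are linearly independent over `ℚ`. -/
theorem pExpr_linearIndependent (p : ℕ) (hp : p.Prime) {n : ℕ} [NeZero n]
    (S : Finset (ZMod n)) (γ : ZMod n → Finset (ZMod n)) :
    LinearIndependent ℚ (fun i : S => pExprLinQ p (γ (i : ZMod n)) (i : ZMod n)) := by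
  have hdet : ((Matrix.of fun d j : ZMod n => pExpr p (γ d) d (Pi.single j 1)).map
      (Int.castRingHom ℚ)).det ≠ 0 := by
    rw [← RingHom.mapMatrix_apply, ← RingHom.map_det]
    simpa using det_pExpr_ne_zero p hp γ
  have hrows := Matrix.linearIndependent_rows_of_det_ne_zero hdet
  have hcoeff : (LinearMap.pi fun j => LinearMap.applyₗ (Pi.single j (1 : ℚ))) ∘
      (fun d : ZMod n => pExprLinQ p (γ d) d) =
      ((Matrix.of fun d j : ZMod n => pExpr p (γ d) d (Pi.single j 1)).map
        (Int.castRingHom ℚ)).row := by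
    ext d j
    have hsingle : (Pi.single j (1 : ℚ) : ZMod n → ℚ) =
        fun k => ((Pi.single j (1 : ℤ) : ZMod n → ℤ) k : ℚ) := by
      ext k
      by_cases hk : k = j <;> simp [hk]
    simp [hsingle, pExprLinQ_intCast]
  have hall : LinearIndependent ℚ (fun d : ZMod n => pExprLinQ p (γ d) d) := by
    refine LinearIndependent.of_comp
      (LinearMap.pi fun j => LinearMap.applyₗ (Pi.single j (1 : ℚ))) ?_
    rw [hcoeff]
    exact hrows
  exact hall.comp _ Subtype.val_injective
end

section
/- Let R ⊆ E_n be a parabolic type, S ⊆ E_n a nonempty subset, and C_γ an S-adapted p-cone that is admissible (i.e. γ(i) is admissible with respect to R and S for every i ∈ S). Then 𝕂(C_γ) = 𝕂_{R,S}. -/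
open scoped Pointwise

/-- The `p`-expression as a linear form. -/
def pExprHom (p : ℕ) {n : ℕ} (T : Finset (ZMod n)) (d : ZMod n) : (ZMod n → ℤ) →ₗ[ℤ] ℤ where
  toFun := pExpr p T d
  map_add' x y := by
    simp only [pExpr, Pi.add_apply, mul_add, Finset.sum_add_distrib]
  map_smul' a x := by
    simp only [pExpr, Pi.smul_apply, smul_eq_mul, Finset.mul_sum, RingHom.id_apply]
    exact Finset.sum_congr rfl fun _ _ => by ring

theorem pExprHom_apply (p : ℕ) {n : ℕ} (T : Finset (ZMod n)) (d : ZMod n) (x : ZMod n → ℤ) :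
    pExprHom p T d x = pExpr p T d x := rfl

theorem pExprHom_single (p : ℕ) {n : ℕ} (T : Finset (ZMod n)) (d : ZMod n) {k : ℕ} (hk : k < n) :
    pExprHom p T d (Pi.single (d + (k : ZMod n)) 1) = (p : ℤ) ^ k * sgn T (d + (k : ZMod n)) := by
  rw [pExprHom_apply, pExpr, Finset.sum_eq_single_of_mem k (Finset.mem_range.2 hk)]
  · simp
  · intro i hi hik
    have hne : d + (i : ZMod n) ≠ d + (k : ZMod n) := fun h => hik <| by
      have h' := (ZMod.natCast_eq_natCast_iff' _ _ _).1 (add_left_cancel h)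
      rwa [Nat.mod_eq_of_lt (Finset.mem_range.1 hi), Nat.mod_eq_of_lt hk] at h'
    simp [Pi.single_eq_of_ne hne]

theorem Admissible.sgn_add_one {n : ℕ} {R S T : Finset (ZMod n)} (h : Admissible R S T)
    {i : ZMod n} (hi : i + 1 ∉ S) : sgn T (i + 1) = -(sgn R i * sgn T i) := by
  have := h i hi
  unfold sgn
  split_ifs at this ⊢ <;> simp_all

/-- The `p`-expressions of admissible sign sets starting in `S` kill `ha^{(j)}` for `j ∉ S`. -/
theorem Admissible.pExprHom_haVec (p : ℕ) {n : ℕ} [NeZero n] {R S T : Finset (ZMod n)}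
    (h : Admissible R S T) {d j : ZMod n} (hd : d ∈ S) (hj : j ∉ S) :
    pExprHom p T d (haVec p R S j) = 0 := by
  obtain ⟨k, hk, rfl⟩ : ∃ k : ℕ, k + 1 < n ∧ d + (k : ZMod n) + 1 = j := by
    have hne : (j - d).val ≠ 0 := by
      rw [Ne, ZMod.val_eq_zero, sub_eq_zero]
      rintro rfl
      exact hj hd
    obtain ⟨k, hk⟩ := Nat.exists_eq_succ_of_ne_zero hne
    refine ⟨k, by simpa [hk] using ZMod.val_lt (j - d), ?_⟩
    have hcast : ((k + 1 : ℕ) : ZMod n) = j - d := by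
      rw [← Nat.succ_eq_add_one, ← hk, ZMod.natCast_zmod_val]
    rw [add_assoc, ← Nat.cast_add_one, hcast, add_sub_cancel]
  have h₁ := pExprHom_single p T d hk
  have h₂ := pExprHom_single p T d (Nat.lt_of_succ_lt hk)
  rw [Nat.cast_add_one, ← add_assoc] at h₁
  rw [haVec, if_neg hj, add_sub_cancel_right, map_sub, map_smul, map_smul, h₁, h₂,
    h.sgn_add_one hj]
  simp only [smul_eq_mul]
  ring

/-- Modulo the `ha^{(j)}` with `j ∉ S`, every vector is supported on `S`. -/
theorem exists_sub_sum_haVec_eq_zero (p : ℕ) {n : ℕ} [NeZero n] (R : Finset (ZMod n))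
    {S : Finset (ZMod n)} (hS : S.Nonempty) (x : ZMod n → ℤ) :
    ∃ c : ZMod n → ℤ, (∀ i ∈ S, c i = 0) ∧
      ∀ j ∉ S, (x - ∑ i, c i • haVec p R S i) j = 0 := by
  let Z : Submodule ℤ (ZMod n → ℤ) := Submodule.pi (S : Set (ZMod n)) fun _ => ⊥
  let W : Submodule ℤ (ZMod n → ℤ) := Submodule.pi ((S : Set (ZMod n))ᶜ) fun _ => ⊥
  let L := Fintype.linearCombination ℤ (haVec p R S)
  obtain ⟨d, hd⟩ := hS
  have single_mem_of_mem {j : ZMod n} (hj : j ∈ S) : Pi.single j (1 : ℤ) ∈ Z.map L ⊔ W := by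
    refine Submodule.mem_sup_right (Submodule.mem_pi.2 fun i hi => ?_)
    have hij : i ≠ j := fun h => hi (h ▸ hj)
    simp [Pi.single_eq_of_ne hij]
  have single_mem_add (k : ℕ) : Pi.single (d + (k : ZMod n)) (1 : ℤ) ∈ Z.map L ⊔ W := by
    induction k with
    | zero => simpa using single_mem_of_mem hd
    | succ k ih =>
      by_cases hj : d + ((k + 1 : ℕ) : ZMod n) ∈ S
      · exact single_mem_of_mem hj
      have ha_mem : haVec p R S (d + ((k + 1 : ℕ) : ZMod n)) ∈ Z.map L ⊔ W := by
        refine Submodule.mem_sup_left ⟨Pi.single (d + ((k + 1 : ℕ) : ZMod n)) 1, ?_, ?_⟩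
        · refine Submodule.mem_pi.2 fun i hi => ?_
          have hij : i ≠ d + ((k + 1 : ℕ) : ZMod n) := fun h => hj (h ▸ hi)
          exact (Submodule.mem_bot ℤ).2 (Pi.single_eq_of_ne hij _)
        · simp [L, Fintype.linearCombination_apply_single]
      have hpred : d + ((k + 1 : ℕ) : ZMod n) - 1 = d + (k : ZMod n) := by
        push_cast
        ring
      have key := Submodule.sub_mem _ (Submodule.neg_mem _ ha_mem)
        (Submodule.smul_mem _ ((p : ℤ) * sgn R (d + (k : ZMod n))) ih)
      rw [haVec, if_neg hj, hpred] at key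
      convert key using 1
      module
  have hx : x ∈ Z.map L ⊔ W := by
    rw [pi_eq_sum_univ' x]
    refine Submodule.sum_mem _ fun j _ => Submodule.smul_mem _ _ ?_
    have h := single_mem_add (j - d).val
    rw [ZMod.natCast_zmod_val, add_sub_cancel] at h
    convert h using 1
  obtain ⟨_, ⟨c, hc, rfl⟩, w, hw, rfl⟩ := Submodule.mem_sup.1 hx
  refine ⟨c, fun i hi => by simpa using Submodule.mem_pi.1 hc i hi, fun j hj => ?_⟩
  have hwj : w j = 0 := by simpa using Submodule.mem_pi.1 hw j hj
  simp [L, Fintype.linearCombination_apply, hwj]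

theorem sgn_isUnit {n : ℕ} (A : Finset (ZMod n)) (i : ZMod n) : IsUnit (sgn A i) := by
  unfold sgn
  split_ifs <;> simp

/-- A vector supported on `S` on which the `p`-expressions starting in `S` vanish is zero. -/
theorem eq_zero_of_pExpr_eq_zero {p : ℕ} (hp : 1 < p) {n : ℕ} [NeZero n] {S : Finset (ZMod n)}
    {γ : ZMod n → Finset (ZMod n)} {y : ZMod n → ℤ} (hy : ∀ j ∉ S, y j = 0)
    (h : ∀ i ∈ S, pExpr p (γ i) i y = 0) : y = 0 := by
  have pow_dvd (m : ℕ) : ∀ j, (p : ℤ) ^ m ∣ y j := by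
    induction m with
    | zero => simp
    | succ m ih =>
      intro j
      by_cases hj : j ∈ S
      · obtain ⟨k, rfl⟩ := Nat.exists_eq_succ_of_ne_zero (NeZero.ne n)
        have h₀ := h j hj
        rw [pExpr, Finset.sum_range_succ'] at h₀
        simp only [pow_zero, one_mul, Nat.cast_zero, add_zero] at h₀
        rw [← (sgn_isUnit (γ j) j).dvd_mul_left, eq_neg_of_add_eq_zero_right h₀, dvd_neg]
        refine Finset.dvd_sum fun i _ => ?_
        rw [pow_succ', pow_succ', mul_assoc, mul_assoc]
        exact mul_dvd_mul_left _ (((ih _).mul_left _).mul_left _)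
      · simp [hy j hj]
  ext j
  refine Int.eq_zero_of_abs_lt_dvd (pow_dvd (y j).natAbs j) ?_
  rw [Int.abs_eq_natAbs]
  exact_mod_cast Nat.lt_pow_self hp

theorem mem_adapCone_and_neg_mem_iff (p : ℕ) {n : ℕ} (S : Finset (ZMod n))
    (γ : ZMod n → Finset (ZMod n)) (x : ZMod n → ℤ) :
    x ∈ adapCone p S γ ∧ -x ∈ adapCone p S γ ↔ ∀ i ∈ S, pExprHom p (γ i) i x = 0 := by
  simp only [adapCone, Set.mem_ofPred_eq, ← pExprHom_apply, map_neg, neg_nonpos, ← forall₂_and,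
    ← le_antisymm_iff]

/-- Proposition 4.23: if `C_γ` is an admissible `S`-adapted `p`-cone, then
`𝕂(C_γ) = 𝕂_{R,S}`. -/
theorem ker_adapCone_eq_haKer (p : ℕ) (hp : p.Prime) {n : ℕ} [NeZero n]
    (R S : Finset (ZMod n)) (hS : S.Nonempty) (γ : ZMod n → Finset (ZMod n))
    (hadm : ∀ i ∈ S, Admissible R S (γ i)) :
    {x | x ∈ adapCone p S γ ∧ -x ∈ adapCone p S γ} = haKer p R S := by
  ext x
  rw [Set.mem_ofPred_eq, mem_adapCone_and_neg_mem_iff]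
  have pExprHom_sum {i : ZMod n} (hi : i ∈ S) {c : ZMod n → ℤ} (hc : ∀ i ∈ S, c i = 0) :
      pExprHom p (γ i) i (∑ j, c j • haVec p R S j) = 0 := by
    rw [map_sum]
    refine Finset.sum_eq_zero fun j _ => ?_
    by_cases hj : j ∈ S
    · simp [hc j hj]
    · rw [map_smul, (hadm i hi).pExprHom_haVec p hi hj, smul_zero]
  constructor
  · intro hx
    obtain ⟨c, hc, hsupp⟩ := exists_sub_sum_haVec_eq_zero p R hS x
    have hzero := eq_zero_of_pExpr_eq_zero hp.one_lt (γ := γ) hsupp fun i hi => by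
      rw [← pExprHom_apply, map_sub, hx i hi, pExprHom_sum hi hc, sub_zero]
    exact ⟨1, le_rfl, c, hc, by simpa using sub_eq_zero.1 hzero⟩
  · rintro ⟨m, hm, c, hc, hmx⟩ i hi
    have h := pExprHom_sum hi hc
    rw [← hmx, map_smul, smul_eq_mul] at h
    exact (mul_eq_zero.1 h).resolve_left (by positivity)
end

section
/- Let R ⊆ E_n be a parabolic type and S ⊆ E_n a nonempty subset. Then the number of subsets T ⊆ E_n that are admissible with respect to R and S equals 2^{|S|}. Moreover, an admissible subset T is uniquely determined by the intersection T ∩ S. -/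
open scoped Pointwise

/-- The membership values along `s, s + 1, s + 2, …` of the admissible set with trace `U` on `S`. -/
def admissibleWalk {n : ℕ} (R S U : Finset (ZMod n)) (s : ZMod n) : ℕ → Prop
  | 0 => s ∈ U
  | k + 1 =>
    if s + k + 1 ∈ S then s + k + 1 ∈ U else (s + k ∈ R ↔ admissibleWalk R S U s k)

theorem ZMod.val_add_one_of_add_one_ne_zero {n : ℕ} [NeZero n] (a : ZMod n) (h : a + 1 ≠ 0) :
    (a + 1).val = a.val + 1 := by
  have hlt : a.val + 1 < n := by
    refine lt_of_le_of_ne a.val_lt fun heq => h ?_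
    have := congrArg (Nat.cast : ℕ → ZMod n) heq
    simpa using this
  have := ZMod.val_cast_of_lt hlt
  simpa using this

theorem Admissible.eq_of_inter_eq {n : ℕ} [NeZero n] {R S T T' : Finset (ZMod n)}
    (hS : S.Nonempty) (hT : Admissible R S T) (hT' : Admissible R S T')
    (h : T ∩ S = T' ∩ S) : T = T' := by
  obtain ⟨s, hs⟩ := hS
  have hmem : ∀ i ∈ S, (i ∈ T ↔ i ∈ T') := fun i hi => by
    simpa [hi] using Finset.ext_iff.mp h i
  have key : ∀ k : ℕ, (s + k ∈ T ↔ s + k ∈ T') := by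
    intro k
    induction k with
    | zero => simpa using hmem s hs
    | succ k ih =>
      rw [Nat.cast_succ, ← add_assoc]
      by_cases hk : s + k + 1 ∈ S
      · exact hmem _ hk
      · have h1 := hT _ hk
        have h2 := hT' _ hk
        split_ifs at h1 h2 <;> tauto
  ext i
  simpa using key (i - s).val

theorem exists_admissible_inter_eq {n : ℕ} [NeZero n] (R : Finset (ZMod n))
    {S U : Finset (ZMod n)} (hS : S.Nonempty) (hU : U ⊆ S) :
    ∃ T, Admissible R S T ∧ T ∩ S = U := by
  classical
  obtain ⟨s, hs⟩ := hS
  refine ⟨Finset.univ.filter fun i => admissibleWalk R S U s (i - s).val, ?_, ?_⟩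
  · intro i hi
    have hne : i - s + 1 ≠ 0 := fun h => hi <| by
      rwa [show i + 1 = s by linear_combination h]
    have hval : (i + 1 - s).val = (i - s).val + 1 := by
      rw [← ZMod.val_add_one_of_add_one_ne_zero _ hne]
      congr 1
      ring
    simp only [Finset.mem_filter, Finset.mem_univ, true_and, hval, admissibleWalk,
      ZMod.natCast_val, ZMod.cast_id', id_eq, add_sub_cancel, hi, if_false]
    split_ifs <;> tauto
  · ext i
    simp only [Finset.mem_inter, Finset.mem_filter, Finset.mem_univ, true_and]
    suffices i ∈ S → (admissibleWalk R S U s (i - s).val ↔ i ∈ U) from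
      ⟨fun h => (this h.2).mp h.1, fun h => ⟨(this (hU h)).mpr h, hU h⟩⟩
    intro hi
    have hcast : s + ((i - s).val : ZMod n) = i := by simp
    cases hk : (i - s).val with
    | zero =>
      rw [hk, Nat.cast_zero, add_zero] at hcast
      rw [admissibleWalk, hcast]
    | succ k =>
      rw [hk, Nat.cast_succ, ← add_assoc] at hcast
      rw [admissibleWalk, hcast, if_pos hi]

/-- There are exactly `2^{|S|}` subsets `T ⊆ E_n` admissible with respect to `R` and `S`;
moreover an admissible subset `T` is uniquely determined by `T ∩ S`. -/
theorem card_admissible_eq_two_pow {n : ℕ} [NeZero n]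
    (R S : Finset (ZMod n)) (hS : S.Nonempty) :
    Nat.card {T : Finset (ZMod n) // Admissible R S T} = 2 ^ S.card ∧
    ∀ T T' : Finset (ZMod n), Admissible R S T → Admissible R S T' →
      T ∩ S = T' ∩ S → T = T' := by
  have huniq : ∀ T T' : Finset (ZMod n), Admissible R S T → Admissible R S T' →
      T ∩ S = T' ∩ S → T = T' := fun _ _ hT hT' h => hT.eq_of_inter_eq hS hT' h
  refine ⟨?_, huniq⟩
  let trace : {T : Finset (ZMod n) // Admissible R S T} → S.powerset :=
    fun T => ⟨T.1 ∩ S, Finset.mem_powerset.mpr Finset.inter_subset_right⟩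
  have htrace : Function.Bijective trace := by
    refine ⟨fun T T' h => Subtype.ext (huniq _ _ T.2 T'.2 (congrArg Subtype.val h)), fun U => ?_⟩
    obtain ⟨T, hT, hTU⟩ := exists_admissible_inter_eq R hS (Finset.mem_powerset.mp U.2)
    exact ⟨⟨T, hT⟩, Subtype.ext hTU⟩
  rw [Nat.card_eq_of_bijective trace htrace, Nat.card_eq_fintype_card, Fintype.card_coe,
    Finset.card_powerset]
end

section
/- Let R ⊆ E_n be a parabolic type and S = {s_1, …, s_r} ⊆ E_n with r ≥ 2 and 1 = s_1 < s_2 < … < s_r ≤ n; set s_{r+1} = s_1 (the subscripts of s are read modulo r). Let T = Φ_R(S) and T_k = Φ_R(S ∖ {s_k}) for 1 ≤ k ≤ r. Assume that s_1 is removable from S (i.e. T_1 = T) and that none of s_2, …, s_r is removable from S (i.e. T_k ≠ T for 2 ≤ k ≤ r). Set λ = p(p^n+1)^{r−1}, λ_k = 2^{k−1}(p^n−1) p^{s_k} (p^n+1)^{r−k−1} for 1 ≤ k ≤ r−1, and λ_r = 2^{r−1} p^{s_r}. Then for all x ∈ ℤ^n one has λ · F_T^{(s_1)}(x) = Σ_{k=1}^{r}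 λ_k · F_{T_{k+1}}^{(s_k)}(x). -/
open scoped Pointwise

/-- Coordinates of a `p`-expression scaled by `p ^ m`, over the representatives `1, …, n`. -/
theorem pow_mul_pExpr (p : ℕ) {n : ℕ} (T : Finset (ZMod n)) (x : ZMod n → ℤ) (m : ℕ)
    (hm : 1 ≤ m) (hmn : m ≤ n) :
    (p : ℤ) ^ m * pExpr p T (m : ZMod n) x =
      ∑ i ∈ Finset.Ico 1 (n + 1),
        (if m ≤ i then 1 else (p : ℤ) ^ n) * ((p : ℤ) ^ i * sgn T (i : ZMod n) * x i) := by
  set f : ℕ → ℤ := fun a => (p : ℤ) ^ a * sgn T (a : ZMod n) * x a with hf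
  have hshift : ∀ a, f (n + a) = (p : ℤ) ^ n * f a := fun a => by
    simp [hf, pow_add, mul_assoc]
  have hleft : (p : ℤ) ^ m * pExpr p T (m : ZMod n) x = ∑ a ∈ Finset.Ico m (n + m), f a := by
    rw [Finset.sum_Ico_eq_sum_range, pExpr, Finset.mul_sum, Nat.add_sub_cancel]
    refine Finset.sum_congr rfl fun i _ => ?_
    simp only [hf, Nat.cast_add, pow_add]
    ring
  have hhigh : ∑ a ∈ Finset.Ico (n + 1) (n + m), f a =
      ∑ a ∈ Finset.Ico 1 m, (p : ℤ) ^ n * f a := by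
    simp only [← hshift]
    rw [Finset.sum_Ico_add f 1 m n, add_comm 1 n, add_comm m n]
  rw [hleft, ← Finset.sum_Ico_consecutive f (by lia : m ≤ n + 1) (by lia), hhigh, add_comm,
    ← Finset.sum_Ico_consecutive _ hm (by lia : m ≤ n + 1)]
  congr 1
  · refine Finset.sum_congr rfl fun i hi => ?_
    rw [if_neg (by have := Finset.mem_Ico.mp hi; lia)]
  · refine Finset.sum_congr rfl fun i hi => ?_
    rw [if_pos (Finset.mem_Ico.mp hi).1, one_mul]

theorem sum_two_pow_mul_pow (q : ℤ) (m : ℕ) :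
    ∑ k ∈ Finset.range m, 2 ^ k * (q - 1) * (q + 1) ^ (m - 1 - k) = (q + 1) ^ m - 2 ^ m := by
  have h := (Commute.all (2 : ℤ) (q + 1)).mul_geom_sum₂ m
  rw [Finset.mul_sum] at h
  rw [← neg_sub (2 ^ m : ℤ), ← h, ← Finset.sum_neg_distrib]
  exact Finset.sum_congr rfl fun k _ => by ring

/-- The identity between the coefficients of a coordinate lying in the block of index `j`. -/
theorem sum_coeff_eq_pow (q : ℤ) (m j : ℕ) (hj : j ≤ m) :
    ∑ k ∈ Finset.range m, 2 ^ k * (q - 1) * (q + 1) ^ (m - 1 - k) *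
        (if k = j then -1 else if k ≤ j then 1 else q) +
      2 ^ m * (if m ≤ j then 1 else q) = (q + 1) ^ m := by
  induction m generalizing j with
  | zero => simp
  | succ m ih =>
    have hexp : ∀ k, m + 1 - 1 - (k + 1) = m - 1 - k := fun k => by lia
    rw [Finset.sum_range_succ']
    simp only [hexp]
    cases j with
    | zero =>
      have h := sum_two_pow_mul_pow q m
      have hsum : ∑ k ∈ Finset.range m, 2 ^ (k + 1) * (q - 1) * (q + 1) ^ (m - 1 - k) *
          (if k + 1 = 0 then -1 else if k + 1 ≤ 0 then 1 else q) =
          2 * q * ((q + 1) ^ m - 2 ^ m) := by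
        rw [← h, Finset.mul_sum]
        refine Finset.sum_congr rfl fun k _ => ?_
        simp only [Nat.add_eq_zero_iff, one_ne_zero, and_false, if_false, nonpos_iff_eq_zero]
        ring
      rw [hsum]
      simp
      ring
    | succ j =>
      have h := ih j (by lia)
      have hsum : ∑ k ∈ Finset.range m, 2 ^ (k + 1) * (q - 1) * (q + 1) ^ (m - 1 - k) *
          (if k + 1 = j + 1 then -1 else if k + 1 ≤ j + 1 then 1 else q) =
          2 * ∑ k ∈ Finset.range m, 2 ^ k * (q - 1) * (q + 1) ^ (m - 1 - k) *
            (if k = j then -1 else if k ≤ j then 1 else q) := by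
        rw [Finset.mul_sum]
        refine Finset.sum_congr rfl fun k _ => ?_
        simp only [add_left_inj, add_le_add_iff_right]
        ring
      rw [hsum]
      simp only [add_le_add_iff_right, zero_le, if_true, (Nat.succ_ne_zero j).symm, if_false,
        Nat.add_sub_cancel, Nat.sub_zero]
      linear_combination 2 * h

theorem natCast_zmod_inj {n a b : ℕ} (ha : 1 ≤ a) (han : a ≤ n) (hb : 1 ≤ b) (hbn : b ≤ n)
    (h : (a : ZMod n) = b) : a = b := by
  rw [ZMod.natCast_eq_natCast_iff] at h
  obtain ⟨c, hc⟩ := h.dvd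
  have hn : (0 : ℤ) < n := by lia
  have h1 : c < 1 := by
    by_contra! hcon
    nlinarith
  have h2 : -1 < c := by
    by_contra! hcon
    nlinarith
  obtain rfl : c = 0 := by lia
  lia

theorem exists_natCast_zmod {n : ℕ} [NeZero n] (i : ZMod n) :
    ∃ a : ℕ, 1 ≤ a ∧ a ≤ n ∧ (a : ZMod n) = i := by
  by_cases h : i.val = 0
  · exact ⟨n, NeZero.one_le, le_rfl, by simpa using ((ZMod.val_eq_zero i).mp h).symm⟩
  · exact ⟨i.val, by lia, i.val_lt.le, ZMod.natCast_zmod_val i⟩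

/-- Away from `S`, agreement of two admissible sets propagates to neighbours. -/
theorem Admissible.mem_iff_mem_iff {n : ℕ} {R S S' T U : Finset (ZMod n)}
    (hT : Admissible R S T) (hU : Admissible R S' U) {i : ZMod n}
    (hS : i + 1 ∉ S) (hS' : i + 1 ∉ S') :
    (i ∈ U ↔ i ∈ T) ↔ (i + 1 ∈ U ↔ i + 1 ∈ T) := by
  have h1 := hT i hS
  have h2 := hU i hS'
  split_ifs at h1 h2 <;> tauto

theorem IPositive.mem_iff_mem {n : ℕ} {R T U : Finset (ZMod n)} {i : ZMod n}
    (hT : IPositive R T (i + 1)) (hU : IPositive R U (i + 1)) : i ∈ U ↔ i ∈ T := by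
  simp only [IPositive, add_sub_cancel_right] at hT hU
  exact hU.trans hT.symm

/-- If `b` is not removable from `S` and `a` precedes `b` in `S`, then removing `b` flips
exactly the membership of the elements of `[a, b)`. -/
theorem mem_iff_mem_iff_of_not_removable {n : ℕ} [NeZero n] {R S T U : Finset (ZMod n)}
    {a b : ℕ} (ha : 1 ≤ a) (hab : a < b) (hbn : b ≤ n)
    (hone : (1 : ZMod n) ∈ S) (haS : (a : ZMod n) ∈ S)
    (hgap : ∀ c : ℕ, a < c → c < b → (c : ZMod n) ∉ S)
    (hT : Admissible R S T) (hTpos : ∀ i ∈ S, IPositive R T i)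
    (hU : Admissible R (S.erase (b : ZMod n)) U)
    (hUpos : ∀ i ∈ S.erase (b : ZMod n), IPositive R U i) (hne : U ≠ T)
    {c : ℕ} (hc : 1 ≤ c) (hcn : c ≤ n) :
    ((c : ZMod n) ∈ U ↔ (c : ZMod n) ∈ T) ↔ ¬ (a ≤ c ∧ c < b) := by
  have hend : ∀ i : ZMod n, i + 1 ∈ S → i + 1 ≠ b → (i ∈ U ↔ i ∈ T) := fun i hi hib =>
    (hTpos _ hi).mem_iff_mem (hUpos _ (Finset.mem_erase.mpr ⟨hib, hi⟩))
  have hstep : ∀ i : ZMod n, i + 1 ∉ S → ((i ∈ U ↔ i ∈ T) ↔ (i + 1 ∈ U ↔ i + 1 ∈ T)) :=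
    fun i hi => hT.mem_iff_mem_iff hU hi fun h => hi (Finset.mem_of_mem_erase h)
  have hout : ∀ c : ℕ, c ≤ n → 1 ≤ c → ¬ (a ≤ c ∧ c < b) →
      ((c : ZMod n) ∈ U ↔ (c : ZMod n) ∈ T) := by
    intro c hcn
    induction hcn using Nat.decreasingInduction with
    | self =>
      intro _ _
      refine hend _ (by simpa using hone) fun h => ?_
      rw [ZMod.natCast_self, zero_add] at h
      have := natCast_zmod_inj le_rfl (by lia) (by lia) hbn (by simpa using h)
      lia
    | of_succ c hcn ih =>
      intro hc hcab
      by_cases hcS : ((c + 1 : ℕ) : ZMod n) ∈ S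
      · refine hend _ (by simpa using hcS) fun h => ?_
        have := natCast_zmod_inj (by lia) hcn (by lia) hbn (by simpa using h)
        lia
      · have hca : c + 1 ≠ a := by
          rintro rfl
          exact hcS haS
        have := ih (by lia) (by lia)
        rw [Nat.cast_add, Nat.cast_one] at this hcS
        exact (hstep _ hcS).mpr this
  have hin : ∀ c : ℕ, c ≤ b - 1 → a ≤ c →
      (((c : ZMod n) ∈ U ↔ (c : ZMod n) ∈ T) ↔
        (((b - 1 : ℕ) : ZMod n) ∈ U ↔ ((b - 1 : ℕ) : ZMod n) ∈ T)) := by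
    intro c hcb
    induction hcb using Nat.decreasingInduction with
    | self => exact fun _ => Iff.rfl
    | of_succ c hcb ih =>
      intro hca
      rw [← ih (by lia), Nat.cast_add, Nat.cast_one]
      exact hstep _ (by simpa using hgap (c + 1) (by lia) (by lia))
  refine ⟨fun h hcab => hne ?_, hout c hcn hc⟩
  ext i
  obtain ⟨d, hd, hdn, rfl⟩ := exists_natCast_zmod i
  by_cases hdab : a ≤ d ∧ d < b
  · exact (hin d (by lia) hdab.1).mpr ((hin c (by lia) hcab.1).mp h)
  · exact hout d hdn hd hdab

theorem sgn_eq_ite {n : ℕ} {T U : Finset (ZMod n)} {i : ZMod n} {P : Prop} [Decidable P]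
    (h : (i ∈ U ↔ i ∈ T) ↔ ¬ P) : sgn U i = (if P then -1 else 1) * sgn T i := by
  unfold sgn
  split_ifs <;> first | rfl | tauto

theorem exists_le_iff_le {r : ℕ} [NeZero r] {s : Fin r → ℕ} (hs : StrictMono s) {i : ℕ}
    (hi : s 0 ≤ i) : ∃ j : Fin r, ∀ k, s k ≤ i ↔ k ≤ j := by
  obtain ⟨j, hj, hmax⟩ := Finset.exists_max_image (Finset.univ.filter fun k => s k ≤ i) id
    ⟨0, by simpa using hi⟩
  simp only [Finset.mem_filter, Finset.mem_univ, true_and, id] at hj hmax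
  exact ⟨j, fun k => ⟨hmax k, fun h => (hs.monotone h).trans hj⟩⟩

/-- The key identity in the case where `s_1` is removable: with
`λ = p(p^n+1)^{r−1}`, `λ_k = 2^{k−1}(p^n−1) p^{s_k}(p^n+1)^{r−k−1}` for `1 ≤ k ≤ r−1`,
and `λ_r = 2^{r−1} p^{s_r}`, one has
`λ·F_T^{(s_1)}(x) = Σ_{k=1}^r λ_k·F_{T_{k+1}}^{(s_k)}(x)` for all `x ∈ ℤ^n`.
Here `S = {s_1 < ⋯ < s_r}` with `s_1 = 1`, `T = Φ_R(S)` and `T_k = Φ_R(S∖{s_k})` are given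
through their characterizing properties (admissibility and positivity), `s_1` is removable
(`T_1 = T`) and no other `s_k` is removable (`T_k ≠ T` for `k ≠ 1`). Indexing is
`0`-based: `s 0 = s_1`, and subscripts of `s`, `T_•` are read modulo `r`. -/
theorem lambda_identity_removable (p : ℕ) (hp : p.Prime) {n : ℕ} [NeZero n]
    (R : Finset (ZMod n)) (r : ℕ) [NeZero r] (hr : 2 ≤ r)
    (s : Fin r → ℕ) (hmono : StrictMono s) (hs0 : s 0 = 1) (hsn : ∀ k, s k ≤ n)
    (S : Finset (ZMod n))
    (hSdef : S = Finset.image (fun k : Fin r => ((s k : ℕ) : ZMod n)) Finset.univ)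
    (T : Finset (ZMod n)) (hTadm : Admissible R S T) (hTpos : ∀ i ∈ S, IPositive R T i)
    (Tk : Fin r → Finset (ZMod n))
    (hTkadm : ∀ k : Fin r, Admissible R (S.erase ((s k : ZMod n))) (Tk k))
    (hTkpos : ∀ k : Fin r, ∀ i ∈ S.erase ((s k : ZMod n)), IPositive R (Tk k) i)
    (hrem : Tk 0 = T) (hirr : ∀ k : Fin r, k ≠ 0 → Tk k ≠ T)
    (x : ZMod n → ℤ) :
    ((p : ℤ) * ((p : ℤ) ^ n + 1) ^ (r - 1)) * pExpr p T ((s 0 : ZMod n)) x =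
      ∑ k : Fin r,
        (if (k : ℕ) = r - 1 then 2 ^ (r - 1) * (p : ℤ) ^ (s k)
          else 2 ^ (k : ℕ) * ((p : ℤ) ^ n - 1) * (p : ℤ) ^ (s k) *
            ((p : ℤ) ^ n + 1) ^ (r - (k : ℕ) - 2)) *
          pExpr p (Tk (k + 1)) ((s k : ZMod n)) x := by
  obtain ⟨m, rfl⟩ : ∃ m, r = m + 1 := ⟨r - 1, by lia⟩
  have hs1 : ∀ k, 1 ≤ s k := fun k => hs0 ▸ hmono.monotone (Fin.zero_le k)
  have hmem : ∀ k, (s k : ZMod n) ∈ S := fun k => by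
    rw [hSdef]
    exact Finset.mem_image_of_mem _ (Finset.mem_univ k)
  have hsgn : ∀ (k : Fin (m + 1)), (k : ℕ) ≠ m → ∀ i ∈ Finset.Ico 1 (n + 1),
      sgn (Tk (k + 1)) (i : ZMod n) =
        (if s k ≤ i ∧ i < s (k + 1) then -1 else 1) * sgn T (i : ZMod n) := by
    intro k hk i hi
    have hi' := Finset.mem_Ico.mp hi
    have hval : ((k + 1 : Fin (m + 1)) : ℕ) = k + 1 :=
      Fin.val_add_one_of_lt (Fin.lt_def.mpr (by simp; lia))
    refine sgn_eq_ite (mem_iff_mem_iff_of_not_removable (hs1 k)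
      (hmono (Fin.lt_def.mpr (hval ▸ k.val.lt_succ_self))) (hsn _) (by simpa [hs0] using hmem 0) (hmem k) ?_
      hTadm hTpos (hTkadm _) (hTkpos _)
      (hirr _ (fun h => by simp [h] at hval)) hi'.1 (by lia))
    intro c hkc hck hcS
    rw [hSdef] at hcS
    obtain ⟨l, -, hl⟩ := Finset.mem_image.mp hcS
    obtain rfl := natCast_zmod_inj (hs1 l) (hsn l) ((hs1 k).trans hkc.le)
      (hck.le.trans (hsn _)) hl
    rw [hmono.lt_iff_lt, Fin.lt_def] at hkc hck
    lia
  set q : ℤ := (p : ℤ) ^ n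
  set f : ℕ → ℤ := fun i => (p : ℤ) ^ i * sgn T (i : ZMod n) * x i
  have hterm : ∀ k : Fin (m + 1),
      (if (k : ℕ) = m + 1 - 1 then 2 ^ (m + 1 - 1) * (p : ℤ) ^ (s k)
          else 2 ^ (k : ℕ) * (q - 1) * (p : ℤ) ^ (s k) *
            (q + 1) ^ (m + 1 - (k : ℕ) - 2)) * pExpr p (Tk (k + 1)) ((s k : ZMod n)) x =
      ∑ i ∈ Finset.Ico 1 (n + 1),
        (if (k : ℕ) = m then 2 ^ m * (if s k ≤ i then 1 else q)
          else 2 ^ (k : ℕ) * (q - 1) * (q + 1) ^ (m - 1 - (k : ℕ)) *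
            ((if s k ≤ i then 1 else q) * (if s k ≤ i ∧ i < s (k + 1) then -1 else 1))) *
          f i := by
    intro k
    have hp := pow_mul_pExpr p (Tk (k + 1)) x (s k) (hs1 k) (hsn k)
    by_cases hk : (k : ℕ) = m
    · obtain rfl : k = Fin.last m := Fin.ext hk
      simp only [Fin.last_add_one, hrem, Fin.val_last, Nat.add_sub_cancel, if_true] at hp ⊢
      rw [mul_assoc, hp, Finset.mul_sum]
      exact Finset.sum_congr rfl fun i _ => by rw [← mul_assoc]
    · rw [if_neg (by lia), (by lia : m + 1 - (k : ℕ) - 2 = m - 1 - k)]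
      calc _ = 2 ^ (k : ℕ) * (q - 1) * (q + 1) ^ (m - 1 - (k : ℕ)) *
            ((p : ℤ) ^ (s k) * pExpr p (Tk (k + 1)) (s k : ZMod n) x) := by ring
        _ = _ := by
          rw [hp, Finset.mul_sum]
          refine Finset.sum_congr rfl fun i hi => ?_
          rw [if_neg hk, hsgn k hk i hi]
          ring
  have hp0 : (p : ℤ) = (p : ℤ) ^ s 0 := by rw [hs0, pow_one]
  rw [Finset.sum_congr rfl fun k _ => hterm k, Finset.sum_comm, Nat.add_sub_cancel,
    mul_comm (p : ℤ), mul_assoc]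
  nth_rewrite 1 [hp0]
  rw [pow_mul_pExpr p T x (s 0) (hs1 0) (hsn 0), Finset.mul_sum]
  refine Finset.sum_congr rfl fun i hi => ?_
  have hi' : s 0 ≤ i := hs0.trans_le (Finset.mem_Ico.mp hi).1
  obtain ⟨j, hj⟩ := exists_le_iff_le hmono hi'
  rw [if_pos hi', one_mul, ← Finset.sum_mul, ← sum_coeff_eq_pow q m j (by lia),
    Fin.sum_univ_castSucc, ← Fin.sum_univ_eq_sum_range (fun k => 2 ^ k * (q - 1) *
      (q + 1) ^ (m - 1 - k) * (if k = j then -1 else if k ≤ j then 1 else q)) m]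
  congr 2
  · refine Finset.sum_congr rfl fun k _ => ?_
    have hk : s k.castSucc ≤ i ↔ (k : ℕ) ≤ j := (hj _).trans Fin.le_def
    have hk1 : i < s (k.castSucc + 1) ↔ (j : ℕ) ≤ k := by
      rw [← not_le, hj, Fin.coeSucc_eq_succ, Fin.le_def, Fin.val_succ]
      lia
    simp only [hk, hk1, Fin.val_castSucc, k.isLt.ne, if_false]
    congr 1
    split_ifs <;> lia
  · simp [hj, Fin.le_def]
end

section
/- Let R ⊆ E_n be a parabolic type, S ⊆ E_n a subset with |S| ≥ 2, T = Φ_R(S), t ∈ S, and gen_{R,S}^{(t)} = δ_T^{(t)} e_t − p δ_R^{(t−1)} e_{t−1}. Then: (1) if t ∉ T, then gen_{R,S}^{(t)} ∈ 𝒞_{pHa,S}; (2) if t ∈ T, then gen_{R,S}^{(t)} ∈ 𝒞_{R, S∖{j}} for every j ∈ S, i.e. gen_{R,S}^{(t)} ∈ ⋂_{j∈S} 𝒞_{R, S∖{j}}. -/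
open scoped Pointwise

/-- The vector `gen_{R,S}^{(t)} = δ_T^{(t)} e_t − p δ_R^{(t−1)} e_{t−1}`,
where `T = Φ_R(S)`. -/
def genVec (p : ℕ) {n : ℕ} (R T : Finset (ZMod n)) (i : ZMod n) : ZMod n → ℤ :=
  sgn T i • Pi.single i (1 : ℤ) - ((p : ℤ) * sgn R (i - 1)) • Pi.single (i - 1) (1 : ℤ)

theorem pExpr_smul_sub_smul (p : ℕ) {n : ℕ} (A : Finset (ZMod n)) (d : ZMod n) (a b : ℤ)
    (x y : ZMod n → ℤ) :
    pExpr p A d (a • x - b • y) = a * pExpr p A d x - b * pExpr p A d y := by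
  simp only [pExpr, Finset.mul_sum, ← Finset.sum_sub_distrib]
  refine Finset.sum_congr rfl fun i _ => ?_
  simp only [Pi.sub_apply, Pi.smul_apply, smul_eq_mul]
  ring

theorem pExpr_single (p : ℕ) {n : ℕ} (A : Finset (ZMod n)) (d : ZMod n) {k : ℕ} (hk : k < n) :
    pExpr p A d (Pi.single (d + (k : ZMod n)) (1 : ℤ)) = (p : ℤ) ^ k * sgn A (d + k) := by
  rw [pExpr, Finset.sum_eq_single_of_mem k (Finset.mem_range.2 hk)]
  · simp
  · intro i hi hik
    rw [Pi.single_eq_of_ne, mul_zero]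
    intro h
    have h' := (ZMod.natCast_eq_natCast_iff' i k n).1 (add_left_cancel h)
    rw [Nat.mod_eq_of_lt (Finset.mem_range.1 hi), Nat.mod_eq_of_lt hk] at h'
    exact hik h'

theorem pExpr_genVec_of_ne (p : ℕ) {n : ℕ} [NeZero n] (R T A : Finset (ZMod n))
    {d t : ZMod n} (h : d ≠ t) :
    pExpr p A d (genVec p R T t) =
      (p : ℤ) ^ (t - d).val * (sgn T t * sgn A t - sgn R (t - 1) * sgn A (t - 1)) := by
  obtain ⟨k, hk⟩ := Nat.exists_eq_succ_of_ne_zero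
    (mt (ZMod.val_eq_zero _).1 (sub_ne_zero.2 h.symm))
  have hkn : k + 1 < n := by simpa [hk] using ZMod.val_lt (t - d)
  have ht : d + ((k + 1 : ℕ) : ZMod n) = t := by
    rw [← Nat.succ_eq_add_one, ← hk, ZMod.natCast_zmod_val]
    ring
  have ht' : d + (k : ZMod n) = t - 1 := by
    rw [← ht]
    push_cast
    ring
  have h1 := pExpr_single p A d hkn
  have h2 := pExpr_single p A d (Nat.lt_of_succ_lt hkn)
  rw [ht] at h1
  rw [ht'] at h2
  rw [genVec, pExpr_smul_sub_smul, h1, h2, hk, Nat.succ_eq_add_one]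
  ring

theorem pExpr_genVec_self (p : ℕ) {n : ℕ} [NeZero n] (R T A : Finset (ZMod n)) (t : ZMod n) :
    pExpr p A t (genVec p R T t) =
      sgn T t * sgn A t - (p : ℤ) ^ n * (sgn R (t - 1) * sgn A (t - 1)) := by
  obtain ⟨k, rfl⟩ := Nat.exists_eq_succ_of_ne_zero (NeZero.ne n)
  have ht' : t + (k : ZMod (k + 1)) = t - 1 := by
    have := ZMod.natCast_self (k + 1)
    push_cast at this
    linear_combination this
  have h1 := pExpr_single p A t (Nat.succ_pos k)
  have h2 := pExpr_single p A t (Nat.lt_succ_self k)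
  rw [Nat.cast_zero, add_zero] at h1
  rw [ht'] at h2
  rw [genVec, pExpr_smul_sub_smul, h1, h2, pow_succ (p : ℤ) k]
  ring

theorem IPositive.sgn_mul_sgn {n : ℕ} {R A : Finset (ZMod n)} {i : ZMod n}
    (h : IPositive R A i) : sgn R (i - 1) * sgn A (i - 1) = 1 := by
  simp only [sgn, IPositive] at *
  split_ifs <;> simp_all

theorem Admissible.sgn_mul_sgn {n : ℕ} {R S A : Finset (ZMod n)} (h : Admissible R S A)
    {i : ZMod n} (hi : i ∉ S) : sgn R (i - 1) * sgn A (i - 1) = -sgn A i := by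
  have h' := h (i - 1) (by rwa [sub_add_cancel])
  rw [sub_add_cancel] at h'
  simp only [sgn]
  split_ifs at h' ⊢ <;> simp_all

theorem haVec_mem_CpHa (p : ℕ) {n : ℕ} [NeZero n] (R S : Finset (ZMod n)) (i : ZMod n) :
    haVec p R S i ∈ CpHa p R S := by
  refine ⟨1, le_rfl, Pi.single i 1, fun k _ => ?_, ?_⟩
  · by_cases hk : k = i <;> simp [hk]
  · simp [Pi.single_apply, ite_smul]

/-- Proposition 5.9: for `t ∈ S` and `T = Φ_R(S)`: (1) if `t ∉ T` then
`gen_{R,S}^{(t)} ∈ 𝒞_{pHa,S}`; (2) if `t ∈ T` then `gen_{R,S}^{(t)} ∈ 𝒞_{R,S∖{j}}` for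
every `j ∈ S`. Here `T` and the `Φ_R(S∖{j}) = TS j` are given through their characterizing
properties, and `𝒞_{R,S∖{j}} = adapCone p (S.erase j) (fun _ => TS j)`. -/
theorem genVec_membership (p : ℕ) (hp : p.Prime) {n : ℕ} [NeZero n]
    (R S : Finset (ZMod n)) (hS : 2 ≤ S.card) (t : ZMod n) (ht : t ∈ S)
    (T : Finset (ZMod n)) (hTadm : Admissible R S T) (hTpos : ∀ i ∈ S, IPositive R T i)
    (TS : ZMod n → Finset (ZMod n))
    (hTSadm : ∀ j ∈ S, Admissible R (S.erase j) (TS j))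
    (hTSpos : ∀ j ∈ S, ∀ i ∈ S.erase j, IPositive R (TS j) i) :
    (t ∉ T → genVec p R T t ∈ CpHa p R S) ∧
    (t ∈ T → ∀ j ∈ S, genVec p R T t ∈ adapCone p (S.erase j) (fun _ => TS j)) := by
  refine ⟨fun h => ?_, fun h j hj i hi => ?_⟩
  · have : genVec p R T t = haVec p R S t := by simp [genVec, haVec, sgn, h, ht]
    exact this ▸ haVec_mem_CpHa p R S t
  have hT : sgn T t = -1 := if_pos h
  have hA : -1 ≤ sgn (TS j) t := by
    rw [sgn]
    split_ifs <;> norm_num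
  by_cases hjt : j = t
  · subst hjt
    rw [pExpr_genVec_of_ne p R T _ (Finset.ne_of_mem_erase hi), hT,
      (hTSadm j hj).sgn_mul_sgn (Finset.notMem_erase j S)]
    simp
  have hpos := (hTSpos j hj t (Finset.mem_erase.2 ⟨Ne.symm hjt, ht⟩)).sgn_mul_sgn
  by_cases hit : i = t
  · subst hit
    have hpn : (1 : ℤ) ≤ (p : ℤ) ^ n := one_le_pow₀ (by exact_mod_cast hp.one_le)
    rw [pExpr_genVec_self, hT, hpos]
    linarith
  · rw [pExpr_genVec_of_ne p R T _ hit, hT, hpos]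
    exact mul_nonpos_of_nonneg_of_nonpos (by positivity) (by linarith)
end
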